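/- Let e ≥ 1. In the polynomial ring R = ℂ[y_0,…,y_e], for 0 ≤ m ≤ 2e set c_m = Σ_{i+j=m, 0≤i,j≤e} y_i y_j, and let Q_e ⊆ R be the ℂ-subalgebra generated by c_0,…,c_{2e}. Then for all 0 ≤ i ≤ j ≤ e there exists k ∈ ℕ such that c_0^k · y_i y_j ∈ Q_e (note c_0 = y_0^2). Consequently, inside the localization R[1/c_0], the localizations of Q_e and of the degree-2 Veronese subalgebra V_e (the ℂ-subalgebra of R generated by all products y_i y_j, 0 ≤ i ≤ j ≤ e) at the element c_0 coincide: V_e[1/c_0] = Q_e[1/c_0]. -/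

import Mathlib

/-!
Statement 5 (fraction-field comparison step in the paper's Lemma "single normalization"):
In `R = ℂ[y₀,…,y_e]`, with `c_m = Σ_{i+j=m} y_i y_j` and `Q_e` the subalgebra generated
by `c_0, …, c_{2e}`, every quadratic monomial `y_i y_j` becomes an element of `Q_e`
after multiplying by a power of `c_0 = y₀²`; consequently, inside the localization
`R[1/c₀]`, the localizations at `c₀` of `Q_e` and of the degree-2 Veronese subalgebra
`V_e` (generated by all the products `y_i y_j`) coincide: `V_e[1/c₀] = Q_e[1/c₀]`.
-/

noncomputable section

/-- The variable `y_i` of `ℂ[y₀,…,y_e]` (and `0` if `i > e`). -/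
def yVar (e i : ℕ) : MvPolynomial (Fin (e + 1)) ℂ :=
  if h : i ≤ e then MvPolynomial.X ⟨i, Nat.lt_succ_of_le h⟩ else 0

/-- `c_m = Σ_{i+j=m, 0 ≤ i,j ≤ e} y_i y_j`. -/
def cCoeff (e m : ℕ) : MvPolynomial (Fin (e + 1)) ℂ :=
  ∑ p ∈ Finset.HasAntidiagonal.antidiagonal m, yVar e p.1 * yVar e p.2

/-- `Q_e`: the subalgebra of `ℂ[y₀,…,y_e]` generated by `c_0, …, c_{2e}`. -/
def Qe (e : ℕ) : Subalgebra ℂ (MvPolynomial (Fin (e + 1)) ℂ) :=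
  Algebra.adjoin ℂ ((fun m => cCoeff e m) '' {m : ℕ | m ≤ 2 * e})

/-- `V_e`: the degree-2 Veronese subalgebra of `ℂ[y₀,…,y_e]`, generated by all
products of two variables. -/
def Ve (e : ℕ) : Subalgebra ℂ (MvPolynomial (Fin (e + 1)) ℂ) :=
  Algebra.adjoin ℂ
    {x | ∃ i j : Fin (e + 1), x = MvPolynomial.X i * MvPolynomial.X j}

theorem adjoin_image_union_invSelf_le {k R S : Type*} [CommSemiring k] [CommRing R] [Algebra k R]
    [CommRing S] [Algebra k S] [Algebra R S] (c : R) [IsLocalization.Away c S]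
    {A B : Subalgebra k R} (h : ∀ x ∈ A, ∃ n : ℕ, c ^ n * x ∈ B) :
    Algebra.adjoin k (algebraMap R S '' (A : Set R) ∪ {IsLocalization.Away.invSelf (S := S) c}) ≤
      Algebra.adjoin k
        (algebraMap R S '' (B : Set R) ∪ {IsLocalization.Away.invSelf (S := S) c}) := by
  refine Algebra.adjoin_le (Set.union_subset ?_
    (Set.subset_union_right.trans Algebra.subset_adjoin))
  rintro _ ⟨x, hx, rfl⟩
  obtain ⟨n, hn⟩ := h x hx
  have hx' : algebraMap R S x =
      IsLocalization.Away.invSelf (S := S) c ^ n * algebraMap R S (c ^ n * x) := by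
    rw [map_mul, map_pow, ← mul_assoc, ← mul_pow, mul_comm (IsLocalization.Away.invSelf _),
      IsLocalization.Away.mul_invSelf, one_pow, one_mul]
  rw [hx']
  exact mul_mem (pow_mem (Algebra.subset_adjoin (Set.mem_union_right _ (Set.mem_singleton _))) n)
    (Algebra.subset_adjoin (Set.mem_union_left _ (Set.mem_image_of_mem _ hn)))

theorem cCoeff_zero (e : ℕ) : cCoeff e 0 = yVar e 0 * yVar e 0 := by
  simp [cCoeff]

theorem cCoeff_mem_Qe {e m : ℕ} (hm : m ≤ 2 * e) : cCoeff e m ∈ Qe e :=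
  Algebra.subset_adjoin ⟨m, hm, rfl⟩

theorem powers_cCoeff_zero_le_Qe (e : ℕ) :
    Submonoid.powers (cCoeff e 0) ≤ (Qe e).toSubmonoid :=
  Submonoid.powers_le.mpr (cCoeff_mem_Qe (Nat.zero_le _))

/-- The elements of `ℂ[y₀,…,y_e]` which a power of `c_0` multiplies into `Q_e`. -/
abbrev QeSaturation (e : ℕ) : Subalgebra ℂ (MvPolynomial (Fin (e + 1)) ℂ) :=
  (Qe e).saturation (Submonoid.powers (cCoeff e 0)) (powers_cCoeff_zero_le_Qe e)

theorem mem_QeSaturation_of_mul_mem {e : ℕ} {x : MvPolynomial (Fin (e + 1)) ℂ}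
    (h : cCoeff e 0 * x ∈ QeSaturation e) : x ∈ QeSaturation e :=
  Subalgebra.mem_saturation_of_mul_mem_left h (Submonoid.mem_powers _)

theorem X_eq_yVar {e : ℕ} (i : Fin (e + 1)) : MvPolynomial.X i = yVar e i := by
  simp [yVar, Nat.lt_succ_iff.mp i.isLt]

theorem yVar_mul_yVar_mem_Ve (e i j : ℕ) : yVar e i * yVar e j ∈ Ve e := by
  by_cases hi : i ≤ e
  · by_cases hj : j ≤ e
    · simp only [yVar, hi, hj, dif_pos]
      exact Algebra.subset_adjoin ⟨_, _, rfl⟩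
    · simp [yVar, hj]
  · simp [yVar, hi]

theorem Qe_le_Ve (e : ℕ) : Qe e ≤ Ve e := by
  refine Algebra.adjoin_le ?_
  rintro _ ⟨m, -, rfl⟩
  exact sum_mem fun p _ => yVar_mul_yVar_mem_Ve e p.1 p.2

theorem cCoeff_add_two (e m : ℕ) :
    cCoeff e (m + 2) = 2 * (yVar e 0 * yVar e (m + 2)) +
      ∑ p ∈ Finset.HasAntidiagonal.antidiagonal m, yVar e (p.1 + 1) * yVar e (p.2 + 1) := by
  rw [cCoeff, Finset.Nat.antidiagonal_succ_succ']
  simp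
  ring

theorem yVar_zero_mul_yVar_mem_QeSaturation {e : ℕ} (m : ℕ) (hm : m ≤ e) :
    yVar e 0 * yVar e m ∈ QeSaturation e := by
  have mem_of_two_mul : ∀ {A : Subalgebra ℂ (MvPolynomial (Fin (e + 1)) ℂ)}
      {x : MvPolynomial (Fin (e + 1)) ℂ}, 2 * x ∈ A → x ∈ A := by
    intro A x hx
    have h := A.smul_mem hx (2⁻¹ : ℂ)
    rwa [two_mul, ← two_smul ℂ x, inv_smul_smul₀ two_ne_zero] at h
  induction m using Nat.strong_induction_on with
  | _ m ih =>
    have hc : cCoeff e m ∈ QeSaturation e :=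
      Subalgebra.le_saturation (cCoeff_mem_Qe (by lia))
    match m with
    | 0 => rwa [← cCoeff_zero]
    | 1 =>
      apply mem_of_two_mul
      convert hc using 1
      simp [cCoeff, Finset.Nat.antidiagonal_succ]
      ring
    | m + 2 =>
      apply mem_of_two_mul
      rw [eq_sub_of_add_eq (cCoeff_add_two e m).symm]
      refine sub_mem hc (sum_mem fun p hp => ?_)
      rw [Finset.HasAntidiagonal.mem_antidiagonal] at hp
      apply mem_QeSaturation_of_mul_mem
      rw [cCoeff_zero, mul_mul_mul_comm]
      exact mul_mem (ih _ (by lia) (by lia)) (ih _ (by lia) (by lia))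

theorem Ve_le_QeSaturation (e : ℕ) :
    Ve e ≤ QeSaturation e := by
  refine Algebra.adjoin_le ?_
  rintro _ ⟨i, j, rfl⟩
  apply mem_QeSaturation_of_mul_mem
  rw [cCoeff_zero, X_eq_yVar, X_eq_yVar, mul_mul_mul_comm]
  exact mul_mem (yVar_zero_mul_yVar_mem_QeSaturation _ (Nat.lt_succ_iff.mp i.isLt))
    (yVar_zero_mul_yVar_mem_QeSaturation _ (Nat.lt_succ_iff.mp j.isLt))

theorem localizations_of_Qe_and_Veronese_agree (e : ℕ) (he : 1 ≤ e) :
    -- some power of `c₀` multiplies each `y_i y_j` into `Q_e`: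
    (∀ i j : Fin (e + 1), (i : ℕ) ≤ (j : ℕ) →
      ∃ k : ℕ, (cCoeff e 0) ^ k * (MvPolynomial.X i * MvPolynomial.X j) ∈ Qe e)
    ∧
    -- consequently `V_e[1/c₀] = Q_e[1/c₀]` inside `R[1/c₀]`:
    Algebra.adjoin ℂ
        ((algebraMap (MvPolynomial (Fin (e + 1)) ℂ)
            (Localization.Away (cCoeff e 0)) '' (Ve e : Set (MvPolynomial (Fin (e + 1)) ℂ)))
          ∪ {IsLocalization.Away.invSelf
              (S := Localization.Away (cCoeff e 0)) (cCoeff e 0)})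
      = Algebra.adjoin ℂ
        ((algebraMap (MvPolynomial (Fin (e + 1)) ℂ)
            (Localization.Away (cCoeff e 0)) '' (Qe e : Set (MvPolynomial (Fin (e + 1)) ℂ)))
          ∪ {IsLocalization.Away.invSelf
              (S := Localization.Away (cCoeff e 0)) (cCoeff e 0)}) := by
  have exists_pow_mul_mem : ∀ x ∈ Ve e, ∃ n : ℕ, cCoeff e 0 ^ n * x ∈ Qe e := by
    intro x hx
    obtain ⟨_, ⟨n, rfl⟩, hn⟩ := Ve_le_QeSaturation e hx
    exact ⟨n, hn⟩
  exact ⟨fun i j _ => exists_pow_mul_mem _ (Algebra.subset_adjoin ⟨i, j, rfl⟩),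
    le_antisymm (adjoin_image_union_invSelf_le _ exists_pow_mul_mem)
      (Algebra.adjoin_mono (Set.union_subset_union_left _ (Set.image_mono (Qe_le_Ve e))))⟩

end
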